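/- Let L be the Laplacian of a strongly connected weighted digraph on N ≥ 2 nodes, let ρ ∈ ℝ^N have all entries strictly positive with ρᵀL = 0 and ∑_i ρ_i = 1, and set R = diag(ρ₁,…,ρ_N). Let c₁,…,c_N : ℝ → ℝ be differentiable and ϖ_i-strongly convex (ϖ_i > 0), and let s* be the unique minimizer of c = ∑_i c_i. Fix β₁ > 0, β₂ > 0. Suppose ȳ, z̄ ∈ ℝ^N satisfy the equilibrium equations R⁻¹·∇c̃(ȳ) + β₁·L·ȳ + β₂·z̄ = 0 and β₁·L·ȳ = 0, where ∇c̃(y) denotes the vector (c₁'(y₁),…,c_N'(y_N)), and suppose ρᵀ·z̄ = 0. Then ȳ = s*·𝟏_N, i.e., every component of ȳ equals the optimal solution s* of the global cost function. -/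

import Mathlib

open Matrix

/-- The Laplacian acts by `(L y)_i = ∑_j a_{ij} (y_i - y_j)`. -/
theorem laplacian_mulVec_apply {n : Type*} [Fintype n] [DecidableEq n] {a : n → n → ℝ}
    (ha_diag : ∀ i, a i i = 0) {L : Matrix n n ℝ}
    (hL : ∀ i j, L i j = if i = j then ∑ k, a i k else -(a i j)) (y : n → ℝ) (i : n) :
    L.mulVec y i = ∑ j, a i j * (y i - y j) := by
  have hterm : ∀ j, L i j * y j = (if i = j then (∑ k, a i k) * y i else 0) - a i j * y j := by
    intro j
    rw [hL]
    split_ifs with h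
    · subst h
      simp [ha_diag]
    · ring
  simp only [Matrix.mulVec, dotProduct, hterm, Finset.sum_sub_distrib, Finset.sum_ite_eq,
    Finset.mem_univ, if_true, mul_sub, Finset.sum_mul]

/-- Maximum principle: a function that is harmonic for the weighted Laplacian of a strongly
connected digraph is constant. -/
theorem eq_of_sum_mul_sub_eq_zero {n : Type*} [Fintype n] {a : n → n → ℝ}
    (ha_nonneg : ∀ i j, 0 ≤ a i j)
    (hconn : ∀ i j : n, i ≠ j → Relation.TransGen (fun p q : n => 0 < a q p) i j)
    {y : n → ℝ} (hy : ∀ i, ∑ j, a i j * (y i - y j) = 0) (i j : n) : y i = y j := by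
  have : Nonempty n := ⟨i⟩
  obtain ⟨m, hm⟩ := Finite.exists_max y
  have step : ∀ p q, 0 < a q p → y q = y m → y p = y m := by
    intro p q hpq hq
    have hterms := (Finset.sum_eq_zero_iff_of_nonneg fun k _ =>
      mul_nonneg (ha_nonneg q k) (sub_nonneg.2 (hq ▸ hm k))).1 (hy q) p (Finset.mem_univ p)
    rcases mul_eq_zero.1 hterms with h | h
    · exact absurd h hpq.ne'
    · linarith
  have eq_max : ∀ k, y k = y m := by
    intro k
    by_cases hk : k = m
    · rw [hk]
    · induction hconn k m hk using Relation.TransGen.head_induction_on with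
      | single h => exact step _ _ h rfl
      | head h _ ih =>
        rename_i p q _
        by_cases hq : q = m
        · exact step _ _ h (by rw [hq])
        · exact step _ _ h (ih hq)
  rw [eq_max i, eq_max j]

/-- Any equilibrium `(ȳ, z̄)` of the optimal coordinator dynamics
(with `ρᵀ z̄ = 0`) satisfies `ȳ = s* 𝟏_N`, where `s*` is the unique minimizer of the
global cost function. -/
theorem coordinator_equilibrium_is_optimal
    (N : ℕ) (hN : 2 ≤ N) (a : Fin N → Fin N → ℝ)
    (ha_nonneg : ∀ i j, 0 ≤ a i j) (ha_diag : ∀ i, a i i = 0)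
    (hconn : ∀ i j : Fin N, i ≠ j →
      Relation.TransGen (fun p q : Fin N => 0 < a q p) i j)
    (L : Matrix (Fin N) (Fin N) ℝ)
    (hL : ∀ i j, L i j = if i = j then ∑ k, a i k else -(a i j))
    (ρ : Fin N → ℝ) (hρpos : ∀ i, 0 < ρ i)
    (hρL : Matrix.vecMul ρ L = 0) (hρsum : ∑ i, ρ i = 1)
    (c c' : Fin N → ℝ → ℝ)
    (hderiv : ∀ (i : Fin N) (x : ℝ), HasDerivAt (c i) (c' i x) x)
    (ϖ : Fin N → ℝ) (hϖ : ∀ i, 0 < ϖ i)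
    (hconv : ∀ (i : Fin N) (x y : ℝ),
      ϖ i * (x - y) ^ 2 ≤ (x - y) * (c' i x - c' i y))
    (sstar : ℝ) (hstar : ∀ s : ℝ, ∑ i, c i sstar ≤ ∑ i, c i s)
    (β₁ β₂ : ℝ) (hβ₁ : 0 < β₁) (hβ₂ : 0 < β₂)
    (ybar zbar : Fin N → ℝ)
    (heq1 : ∀ i, (ρ i)⁻¹ * c' i (ybar i) + β₁ * L.mulVec ybar i + β₂ * zbar i = 0)
    (heq2 : β₁ • L.mulVec ybar = 0)
    (hzbar : ∑ i, ρ i * zbar i = 0) :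
    ybar = fun _ => sstar := by
  have hLy : ∀ i, L.mulVec ybar i = 0 := fun i =>
    congrFun ((smul_eq_zero.1 heq2).resolve_left hβ₁.ne') i
  have hconst := eq_of_sum_mul_sub_eq_zero ha_nonneg hconn fun i =>
    (laplacian_mulVec_apply ha_diag hL ybar i).symm.trans (hLy i)
  have hgrad_star : ∑ i, c' i sstar = 0 :=
    IsLocalMin.hasDerivAt_eq_zero (f := fun s => ∑ i, c i s) (Filter.Eventually.of_forall hstar)
      (HasDerivAt.fun_sum fun i _ => hderiv i sstar)
  have hgrad : ∑ i, c' i (ybar i) = 0 := by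
    have hterm : ∀ i, c' i (ybar i) = -β₂ * (ρ i * zbar i) := by
      intro i
      have h := heq1 i
      have hρ := (hρpos i).ne'
      rw [hLy i] at h
      field_simp at h
      linarith
    simp only [hterm, ← Finset.mul_sum, hzbar, mul_zero]
  funext k
  have hmono : (∑ i, ϖ i) * (ybar k - sstar) ^ 2 ≤ 0 := by
    calc (∑ i, ϖ i) * (ybar k - sstar) ^ 2
        ≤ ∑ i, (ybar k - sstar) * (c' i (ybar i) - c' i sstar) := by
          rw [Finset.sum_mul]
          refine Finset.sum_le_sum fun i _ => ?_
          rw [hconst i k]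
          exact hconv i _ _
      _ = 0 := by
          rw [← Finset.mul_sum, Finset.sum_sub_distrib, hgrad, hgrad_star, sub_zero, mul_zero]
  have hpos : 0 < ∑ i, ϖ i := Finset.sum_pos (fun i _ => hϖ i) ⟨k, Finset.mem_univ k⟩
  have hsq : (ybar k - sstar) ^ 2 = 0 :=
    le_antisymm (nonpos_of_mul_nonpos_right hmono hpos) (sq_nonneg _)
  exact sub_eq_zero.1 (pow_eq_zero_iff two_ne_zero |>.1 hsq)
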